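/- Let γ ∈ (0, 1/L] and let T be a proximal-gradient map for (f, g, γ). Define t_0 := 0 and t_{j+1} := (1 + √(1 + 4·t_j²))/2 for j ≥ 0. Given x_0 ∈ ℝⁿ, define the alternated-extrapolation sequences by y_{−1} := y_0 := x_0 and, for every even k ≥ 0: y_{k+1} := T x_k, x_{k+1} := y_{k+1} − (1/t_{k/2+1})(y_{k+1} − y_k) + ((t_{k/2} − 1)/t_{k/2+1})(y_k − y_{k−1}), y_{k+2} := T x_{k+1}, x_{k+2} := y_{k+2}. Then for every x⋆ ∈ X⋆ and every j ≥ 1: F(y_{2j}) − F⋆ ≤ ‖x_0 − x⋆‖²/(2γ·t_j²) ≤ 2‖x_0 − x⋆‖²/(γ·(j+1)²), i.e. the worst-case functional rate is O(1/k²). -/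

import Mathlib

open scoped RealInnerProductSpace

section ProximalGradient

variable {E : Type*} [NormedAddCommGroup E] [InnerProductSpace ℝ E]

/-- The derivative of a differentiable function along a line. -/
theorem HasGradientAt.hasDerivAt_comp_line [CompleteSpace E] {f : E → ℝ} {v x d : E} {s : ℝ}
    (h : HasGradientAt f v (x + s • d)) :
    HasDerivAt (fun r : ℝ => f (x + r • d)) ⟪v, d⟫ s := by
  have hline : HasDerivAt (fun r : ℝ => x + r • d) d s := by
    simpa using ((hasDerivAt_id s).smul_const d).const_add x
  have hcomp := h.hasFDerivAt.comp_hasDerivAt s hline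
  rwa [InnerProductSpace.toDual_apply_apply] at hcomp

/-- The first-order lower bound for a convex function. -/
theorem ConvexOn.add_inner_gradient_le [CompleteSpace E] {f : E → ℝ}
    (hf : ConvexOn ℝ Set.univ f) {v x : E} (h : HasGradientAt f v x) (w : E) :
    f x + ⟪v, w - x⟫ ≤ f w := by
  have hconv : ConvexOn ℝ Set.univ (fun r : ℝ => f (x + r • (w - x))) := by
    have := hf.comp_affineMap (AffineMap.lineMap x w)
    simpa [Function.comp_def, AffineMap.lineMap_apply, add_comm] using this
  have hder : HasDerivAt (fun r : ℝ => f (x + r • (w - x))) ⟪v, w - x⟫ 0 :=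
    HasGradientAt.hasDerivAt_comp_line (by simpa using h)
  have hslope := hconv.le_slope_of_hasDerivAt (Set.mem_univ 0) (Set.mem_univ 1) one_pos hder
  simp [slope_def_field] at hslope
  linarith

/-- The descent lemma: the quadratic upper bound for a function with Lipschitz gradient. -/
theorem le_add_inner_gradient_add_sq [CompleteSpace E] {f : E → ℝ} {f' : E → E} {L : ℝ}
    (hf : ∀ x, HasGradientAt f (f' x) x) (hlip : ∀ x y, ‖f' x - f' y‖ ≤ L * ‖x - y‖) (x w : E) :
    f w ≤ f x + ⟪f' x, w - x⟫ + L / 2 * ‖w - x‖ ^ 2 := by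
  set d := w - x with hd
  have hder : ∀ s : ℝ, HasDerivAt
      (fun r : ℝ => f (x + r • d) - r * ⟪f' x, d⟫ - L / 2 * ‖d‖ ^ 2 * r ^ 2)
      (⟪f' (x + s • d), d⟫ - ⟪f' x, d⟫ - L * ‖d‖ ^ 2 * s) s := by
    intro s
    refine (((hf (x + s • d)).hasDerivAt_comp_line.sub
      ((hasDerivAt_id s).mul_const ⟪f' x, d⟫)).sub
      ((hasDerivAt_pow 2 s).const_mul (L / 2 * ‖d‖ ^ 2))).congr_deriv ?_
    norm_num
    ring
  have hanti := antitoneOn_of_deriv_nonpos (convex_Icc (0 : ℝ) 1)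
    (fun s _ => (hder s).continuousAt.continuousWithinAt)
    (fun s _ => (hder s).differentiableAt.differentiableWithinAt)
    (fun s hs => by
      rw [interior_Icc] at hs
      rw [(hder s).deriv, ← inner_sub_left]
      have hnorm : ‖f' (x + s • d) - f' x‖ ≤ L * (s * ‖d‖) := by
        simpa [norm_smul, abs_of_pos hs.1] using hlip (x + s • d) x
      have hinner := real_inner_le_norm (f' (x + s • d) - f' x) d
      nlinarith [mul_le_mul_of_nonneg_right hnorm (norm_nonneg d)])
  have hle := hanti (Set.left_mem_Icc.2 zero_le_one) (Set.right_mem_Icc.2 zero_le_one) zero_le_one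
  simp [hd] at hle
  rw [← hd] at hle
  linarith

/-- The three-point inequality for a minimizer of a convex function plus a squared distance. -/
theorem ConvexOn.three_point_of_forall_le {g : E → ℝ} (hg : ConvexOn ℝ Set.univ g) {c : ℝ}
    {p z : E} (hz : ∀ w, g z + c * ‖z - p‖ ^ 2 ≤ g w + c * ‖w - p‖ ^ 2) (w : E) :
    g z + c * ‖z - p‖ ^ 2 + c * ‖w - z‖ ^ 2 ≤ g w + c * ‖w - p‖ ^ 2 := by
  have hsq : ∀ s : ℝ, ‖z + s • (w - z) - p‖ ^ 2 =
      ‖z - p‖ ^ 2 + 2 * s * ⟪z - p, w - z⟫ + s ^ 2 * ‖w - z‖ ^ 2 := by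
    intro s
    rw [show z + s • (w - z) - p = (z - p) + s • (w - z) by abel, norm_add_sq_real,
      real_inner_smul_right, norm_smul, mul_pow, Real.norm_eq_abs, sq_abs]
    ring
  have hone : ‖w - p‖ ^ 2 = ‖z - p‖ ^ 2 + 2 * ⟪z - p, w - z⟫ + ‖w - z‖ ^ 2 := by
    simpa using hsq 1
  have hstep : ∀ s ∈ Set.Ioo (0 : ℝ) 1,
      0 ≤ g w - g z + 2 * c * ⟪z - p, w - z⟫ + s * (c * ‖w - z‖ ^ 2) := by
    intro s hs
    have hmin := hz (z + s • (w - z))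
    rw [hsq] at hmin
    have hconv := hg.2 (Set.mem_univ z) (Set.mem_univ w) (sub_nonneg.2 hs.2.le) hs.1.le
      (sub_add_cancel 1 s)
    rw [show (1 - s) • z + s • w = z + s • (w - z) by module] at hconv
    simp only [smul_eq_mul] at hconv
    refine (mul_nonneg_iff_of_pos_left hs.1).1 ?_
    nlinarith
  have hlim : Filter.Tendsto
      (fun s : ℝ => g w - g z + 2 * c * ⟪z - p, w - z⟫ + s * (c * ‖w - z‖ ^ 2))
      (nhdsWithin 0 (Set.Ioi 0)) (nhds (g w - g z + 2 * c * ⟪z - p, w - z⟫)) := by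
    refine Filter.Tendsto.mono_left ?_ nhdsWithin_le_nhds
    have hcont : Continuous
        (fun s : ℝ => g w - g z + 2 * c * ⟪z - p, w - z⟫ + s * (c * ‖w - z‖ ^ 2)) := by
      fun_prop
    simpa using hcont.tendsto 0
  have hnonneg := ge_of_tendsto hlim
    (Filter.eventually_of_mem (Ioo_mem_nhdsGT one_pos) hstep)
  rw [hone]
  linarith

/-- The fundamental inequality for a proximal-gradient step of size at most `1 / L`. -/
theorem proximal_gradient_step_le [CompleteSpace E] {f g : E → ℝ} {f' : E → E} {L γ : ℝ}
    (hγ : 0 < γ) (hγL : L ≤ 1 / γ)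
    (hf_conv : ConvexOn ℝ Set.univ f) (hf : ∀ x, HasGradientAt f (f' x) x)
    (hlip : ∀ x y, ‖f' x - f' y‖ ≤ L * ‖x - y‖) (hg : ConvexOn ℝ Set.univ g) {x z : E}
    (hz : ∀ w, g z + (1 / (2 * γ)) * ‖z - (x - γ • f' x)‖ ^ 2
      ≤ g w + (1 / (2 * γ)) * ‖w - (x - γ • f' x)‖ ^ 2) (w : E) :
    2 * γ * (f z + g z) + ‖z - w‖ ^ 2 ≤ 2 * γ * (f w + g w) + ‖x - w‖ ^ 2 := by
  have hprox := hg.three_point_of_forall_le hz w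
  have hdescent := le_add_inner_gradient_add_sq hf hlip x z
  have hlower := hf_conv.add_inner_gradient_le (hf x) w
  have hexp : ∀ u : E, ‖u - (x - γ • f' x)‖ ^ 2 =
      ‖u - x‖ ^ 2 + 2 * γ * ⟪f' x, u - x⟫ + γ ^ 2 * ‖f' x‖ ^ 2 := by
    intro u
    rw [show u - (x - γ • f' x) = (u - x) + γ • f' x by abel, norm_add_sq_real,
      real_inner_smul_right, norm_smul, mul_pow, Real.norm_eq_abs, sq_abs, real_inner_comm]
    ring
  rw [hexp, hexp] at hprox
  rw [norm_sub_rev z w, norm_sub_rev x w]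
  have hLγ : L * γ ≤ 1 := (le_div_iff₀ hγ).1 hγL
  have hquad : L * γ * ‖z - x‖ ^ 2 ≤ 1 * ‖z - x‖ ^ 2 :=
    mul_le_mul_of_nonneg_right hLγ (sq_nonneg _)
  have hprox' := mul_le_mul_of_nonneg_left hprox (by positivity : (0 : ℝ) ≤ 2 * γ)
  have hdescent' := mul_le_mul_of_nonneg_left hdescent (by positivity : (0 : ℝ) ≤ 2 * γ)
  have hlower' := mul_le_mul_of_nonneg_left hlower (by positivity : (0 : ℝ) ≤ 2 * γ)
  have hcancel : ∀ a : ℝ, 2 * γ * (1 / (2 * γ) * a) = a := by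
    intro a
    field_simp
  simp only [mul_add, hcancel] at hprox' hdescent' hlower' ⊢
  linarith

/-- One accelerated step: the decrease of the Lyapunov function when the fundamental inequality
holds at the extrapolated point, with values `F` (scaled by `c`) at `v`, `u` and the comparison
point `a`. -/
theorem accelerated_step_le {F : E → ℝ} {c τ : ℝ} (hτ : 1 ≤ τ) {x u v a z : E}
    (hx : τ • x = (τ - 1) • v + z)
    (hstep : ∀ w, c * F u + ‖u - w‖ ^ 2 ≤ c * F w + ‖x - w‖ ^ 2) :
    c * (τ ^ 2 * (F u - F a)) + ‖v + τ • (u - v) - a‖ ^ 2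
      ≤ c * ((τ ^ 2 - τ) * (F v - F a)) + ‖z - a‖ ^ 2 := by
  have hz : z = v + τ • (x - v) := by
    rw [smul_sub, hx]
    module
  have hexp : ∀ b : E, ‖v + τ • (b - v) - a‖ ^ 2 =
      (τ ^ 2 - τ) * ‖b - v‖ ^ 2 + τ * ‖b - a‖ ^ 2 - (τ - 1) * ‖v - a‖ ^ 2 := by
    intro b
    have hb : ‖b - a‖ ^ 2 = ‖b - v‖ ^ 2 + 2 * ⟪b - v, v - a⟫ + ‖v - a‖ ^ 2 := by
      rw [← norm_add_sq_real, sub_add_sub_cancel]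
    rw [show v + τ • (b - v) - a = τ • (b - v) + (v - a) by abel, norm_add_sq_real,
      real_inner_smul_left, norm_smul, mul_pow, Real.norm_eq_abs, sq_abs, hb]
    ring
  rw [hz, hexp, hexp]
  have hv := mul_le_mul_of_nonneg_left (hstep v)
    (by nlinarith : (0 : ℝ) ≤ τ ^ 2 - τ)
  have ha := mul_le_mul_of_nonneg_left (hstep a) (by linarith : (0 : ℝ) ≤ τ)
  nlinarith

end ProximalGradient

theorem one_le_of_sqrt_rec {t : ℕ → ℝ}
    (htrec : ∀ j, t (j + 1) = (1 + Real.sqrt (1 + 4 * (t j) ^ 2)) / 2)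
    (j : ℕ) : 1 ≤ t (j + 1) := by
  have : 1 ≤ Real.sqrt (1 + 4 * t j ^ 2) := Real.one_le_sqrt.2 (by nlinarith [sq_nonneg (t j)])
  rw [htrec]
  linarith

theorem sq_sub_self_of_sqrt_rec {t : ℕ → ℝ}
    (htrec : ∀ j, t (j + 1) = (1 + Real.sqrt (1 + 4 * (t j) ^ 2)) / 2)
    (j : ℕ) : t (j + 1) ^ 2 - t (j + 1) = t j ^ 2 := by
  have := Real.sq_sqrt (by positivity : (0 : ℝ) ≤ 1 + 4 * t j ^ 2)
  rw [htrec]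
  linarith

theorem add_one_half_le_of_sqrt_rec {t : ℕ → ℝ}
    (htrec : ∀ j, t (j + 1) = (1 + Real.sqrt (1 + 4 * (t j) ^ 2)) / 2)
    {j : ℕ} (hj : 1 ≤ j) : ((j : ℝ) + 1) / 2 ≤ t j := by
  induction j, hj using Nat.le_induction with
  | base => simpa using one_le_of_sqrt_rec htrec 0
  | succ j hj ih =>
    have : 2 * t j ≤ Real.sqrt (1 + 4 * t j ^ 2) := Real.le_sqrt_of_sq_le (by linarith)
    rw [htrec]
    push_cast
    linarith

theorem stmt_19
    (n : ℕ) (hn : 0 < n)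
    (L γ : ℝ) (hL : 0 < L) (hγ : 0 < γ) (hγ2 : γ ≤ 1 / L)
    (f g : EuclideanSpace ℝ (Fin n) → ℝ)
    (f' : EuclideanSpace ℝ (Fin n) → EuclideanSpace ℝ (Fin n))
    (hf_conv : ConvexOn ℝ Set.univ f)
    (hf_diff : ∀ x, HasGradientAt f (f' x) x)
    (hf_lip : ∀ x y, ‖f' x - f' y‖ ≤ L * ‖x - y‖)
    (hg_conv : ConvexOn ℝ Set.univ g)
    (T : EuclideanSpace ℝ (Fin n) → EuclideanSpace ℝ (Fin n))
    (hT : ∀ x w, g (T x) + (1 / (2 * γ)) * ‖T x - (x - γ • f' x)‖ ^ 2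
        ≤ g w + (1 / (2 * γ)) * ‖w - (x - γ • f' x)‖ ^ 2)
    (t : ℕ → ℝ) (ht0 : t 0 = 0)
    (htrec : ∀ j, t (j + 1) = (1 + Real.sqrt (1 + 4 * (t j) ^ 2)) / 2)
    (x₀ : EuclideanSpace ℝ (Fin n))
    (x : ℕ → EuclideanSpace ℝ (Fin n))
    (y : ℤ → EuclideanSpace ℝ (Fin n))
    (hym1 : y (-1) = x₀) (hy0 : y 0 = x₀) (hx0 : x 0 = x₀)
    (hseq : ∀ k : ℕ, Even k →
        y ((k : ℤ) + 1) = T (x k)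
      ∧ x (k + 1) = y ((k : ℤ) + 1)
          - (1 / t (k / 2 + 1)) • (y ((k : ℤ) + 1) - y (k : ℤ))
          + ((t (k / 2) - 1) / t (k / 2 + 1)) • (y (k : ℤ) - y ((k : ℤ) - 1))
      ∧ y ((k : ℤ) + 2) = T (x (k + 1))
      ∧ x (k + 2) = y ((k : ℤ) + 2)) :
    ∀ xstar, (∀ w, f xstar + g xstar ≤ f w + g w) →
      ∀ j : ℕ, 1 ≤ j →
        (f (y (2 * (j : ℤ))) + g (y (2 * (j : ℤ)))) - (f xstar + g xstar)
            ≤ ‖x₀ - xstar‖ ^ 2 / (2 * γ * (t j) ^ 2)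
        ∧ ‖x₀ - xstar‖ ^ 2 / (2 * γ * (t j) ^ 2)
            ≤ 2 * ‖x₀ - xstar‖ ^ 2 / (γ * ((j : ℝ) + 1) ^ 2) := by
  intro a _ j hj
  have hstep : ∀ p w, 2 * γ * (f (T p) + g (T p)) + ‖T p - w‖ ^ 2
      ≤ 2 * γ * (f w + g w) + ‖p - w‖ ^ 2 := fun p w =>
    proximal_gradient_step_le hγ ((le_div_comm₀ hγ hL).1 hγ2) hf_conv hf_diff hf_lip hg_conv
      (hT p) w
  have hx_even : ∀ i : ℕ, x (2 * i) = y (2 * (i : ℤ)) := by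
    intro i
    cases i with
    | zero => simp [hx0, hy0]
    | succ i =>
      have h := (hseq (2 * i) (even_two_mul i)).2.2.2
      rw [show 2 * (i + 1) = 2 * i + 2 by ring, h]
      congr 1
  have henergy : ∀ i : ℕ,
      2 * γ * (t i ^ 2 * ((f (y (2 * (i : ℤ))) + g (y (2 * (i : ℤ)))) - (f a + g a)))
        + ‖y (2 * (i : ℤ) - 1) + t i • (y (2 * (i : ℤ)) - y (2 * (i : ℤ) - 1)) - a‖ ^ 2
      ≤ ‖x₀ - a‖ ^ 2 := by
    intro i
    induction i with
    | zero => simp [ht0, hym1]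
    | succ i ih =>
      obtain ⟨hy_odd, hx_odd, hy_even, -⟩ := hseq (2 * i) (even_two_mul i)
      rw [Nat.mul_div_cancel_left i two_pos] at hx_odd
      rw [hx_even] at hy_odd
      push_cast at hy_odd hx_odd hy_even ⊢
      have hτ := one_le_of_sqrt_rec htrec i
      have hτ0 : t (i + 1) ≠ 0 := by positivity
      have hextra : t (i + 1) • x (2 * i + 1) = (t (i + 1) - 1) • y (2 * (i : ℤ) + 1)
          + (y (2 * (i : ℤ) - 1) + t i • (y (2 * (i : ℤ)) - y (2 * (i : ℤ) - 1))) := by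
        rw [hx_odd, smul_add, smul_sub, smul_smul, smul_smul, mul_one_div_cancel hτ0,
          mul_div_cancel₀ _ hτ0]
        module
      have hacc := accelerated_step_le (F := fun w => f w + g w) (a := a) hτ hextra
        (hstep (x (2 * i + 1)))
      rw [sq_sub_self_of_sqrt_rec htrec, ← hy_even] at hacc
      have hdesc : f (y (2 * (i : ℤ) + 1)) + g (y (2 * (i : ℤ) + 1))
          ≤ f (y (2 * (i : ℤ))) + g (y (2 * (i : ℤ))) := by
        have h := hstep (y (2 * (i : ℤ))) (y (2 * (i : ℤ)))
        rw [← hy_odd, sub_self, norm_zero] at h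
        refine le_of_mul_le_mul_left ?_ (by positivity : (0 : ℝ) < 2 * γ)
        nlinarith [sq_nonneg ‖y (2 * (i : ℤ) + 1) - y (2 * (i : ℤ))‖]
      have hscaled := mul_le_mul_of_nonneg_left (sub_le_sub_right hdesc (f a + g a))
        (by positivity : (0 : ℝ) ≤ 2 * γ * t i ^ 2)
      rw [show 2 * ((i : ℤ) + 1) = 2 * i + 2 by ring, show 2 * (i : ℤ) + 2 - 1 = 2 * i + 1 by ring]
      linarith
  have htj := add_one_half_le_of_sqrt_rec htrec hj
  have htj0 : 0 < t j := lt_of_lt_of_le (by positivity) htj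
  constructor
  · rw [le_div_iff₀ (by positivity)]
    nlinarith [henergy j, sq_nonneg
      ‖y (2 * (j : ℤ) - 1) + t j • (y (2 * (j : ℤ)) - y (2 * (j : ℤ) - 1)) - a‖]
  · have hsq : (((j : ℝ) + 1) / 2) ^ 2 ≤ t j ^ 2 := by gcongr
    rw [show 2 * ‖x₀ - a‖ ^ 2 / (γ * ((j : ℝ) + 1) ^ 2)
      = ‖x₀ - a‖ ^ 2 / (2 * γ * (((j : ℝ) + 1) / 2) ^ 2) by field_simp]
    gcongr
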